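/- arXiv:2311.14491 — 2 statements merged into one kernel-verified Lean document; each statement's English description precedes it below -/
import Mathlib

section
/- There exists a sequence (a_k)_{k≥1} of vectors a_k ∈ ℤ³ such that |a_k|² = 4k+1 for every k ≥ 1 and |a_k · a_{k+1}| ≤ (1/√3)·|a_k|·|a_{k+1}| for every k ≥ 1, where · denotes the Euclidean inner product on ℝ³ and |·| the Euclidean norm. -/
open Real

/-- The ternary quadratic form `a x² + b y² + c z² + 2 p y z + 2 q x z + 2 r x y`. -/
def ternaryForm (a b c p q r x y z : ℤ) : ℤ :=
  a * x ^ 2 + b * y ^ 2 + c * z ^ 2 + 2 * p * y * z + 2 * q * x * z + 2 * r * x * y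

theorem exists_two_mul_abs_add_mul_le (r : ℤ) {a : ℤ} (ha : 0 < a) :
    ∃ k : ℤ, 2 * |r + k * a| ≤ a := by
  refine ⟨-((2 * r + a) / (2 * a)), ?_⟩
  have h1 := Int.emod_nonneg (2 * r + a) (show 2 * a ≠ 0 by omega)
  have h2 := Int.emod_lt_of_pos (2 * r + a) (show 0 < 2 * a by omega)
  have h3 := Int.emod_add_mul_ediv (2 * r + a) (2 * a)
  rcases abs_cases (r + -((2 * r + a) / (2 * a)) * a) with ⟨h, -⟩ | ⟨h, -⟩ <;> rw [h] <;> linarith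

/-- A reduced positive definite ternary form of determinant one is a sum of three squares. -/
theorem ternaryForm_reduced {a b c p q r : ℤ} (ha : 0 < a) (hg : 0 < a * b - r ^ 2)
    (hdet : a * b * c + 2 * p * q * r - a * p ^ 2 - b * q ^ 2 - c * r ^ 2 = 1)
    (hr : 2 * |r| ≤ a) (hp : 2 * |a * p - q * r| ≤ a * b - r ^ 2)
    (hab : a ≤ b) (hgg : a * b - r ^ 2 ≤ a * c - q ^ 2) (x y z : ℤ) :
    ternaryForm a b c p q r x y z = (x + q * z) ^ 2 + y ^ 2 + z ^ 2 := by
  have key : (a * b - r ^ 2) * (a * c - q ^ 2) - (a * p - q * r) ^ 2 = a := by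
    linear_combination a * hdet
  set g := a * b - r ^ 2 with hgdef
  set h := a * p - q * r with hhdef
  set k := a * c - q ^ 2 with hkdef
  have hh : 4 * h ^ 2 ≤ g ^ 2 := by
    nlinarith [abs_nonneg h, sq_abs h]
  have hrr : 4 * r ^ 2 ≤ a ^ 2 := by
    nlinarith [abs_nonneg r, sq_abs r]
  have h1 : 3 * g ^ 2 ≤ 4 * a := by nlinarith
  have h2 : 3 * a ^ 2 ≤ 4 * g := by nlinarith
  have ha1 : a = 1 := by
    by_contra hne
    have : 2 ≤ a := by omega
    have hga : g < a := by nlinarith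
    nlinarith
  have hg1 : g = 1 := by nlinarith
  have hr0 : r = 0 := by
    rw [← abs_eq_zero]; have := abs_nonneg r; omega
  have hh0 : h = 0 := by
    rw [← abs_eq_zero]; have := abs_nonneg h; omega
  subst hr0
  subst ha1
  have hp0 : p = 0 := by linarith
  have hb1 : b = 1 := by linarith
  subst hp0 hb1
  have hc : c = 1 + q ^ 2 := by linarith
  subst hc
  unfold ternaryForm
  ring

/-- Every value of a positive definite integral ternary form of determinant one is a sum of three
squares. -/
theorem exists_sq_add_sq_add_sq_eq_ternaryForm (a b c p q r : ℤ) (ha : 0 < a)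
    (hg : 0 < a * b - r ^ 2)
    (hdet : a * b * c + 2 * p * q * r - a * p ^ 2 - b * q ^ 2 - c * r ^ 2 = 1) (x y z : ℤ) :
    ∃ u v w : ℤ, u ^ 2 + v ^ 2 + w ^ 2 = ternaryForm a b c p q r x y z := by
  induction hA : a.toNat using Nat.strong_induction_on generalizing a b c p q r x y z with
  | _ A ihA =>
  induction hG : (a * b - r ^ 2).toNat using Nat.strong_induction_on
    generalizing a b c p q r x y z with
  | _ G ihG =>
  obtain ⟨k, hk⟩ := exists_two_mul_abs_add_mul_le r ha
  obtain ⟨m, hm⟩ := exists_two_mul_abs_add_mul_le (a * p - q * r) hg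
  set r' := r + k * a with hr'
  set b' := b + 2 * k * r + k ^ 2 * a with hb'
  set p' := p + k * q + m * b' with hp'
  set q' := q + m * r' with hq'
  set c' := c + 2 * m * (p + k * q) + m ^ 2 * b' with hc'
  have hgeq : a * b' - r' ^ 2 = a * b - r ^ 2 := by rw [hb', hr']; ring
  have hheq : a * p' - q' * r' = a * p - q * r + m * (a * b - r ^ 2) := by
    rw [hp', hq', hb', hr']; ring
  have hdet' : a * b' * c' + 2 * p' * q' * r' - a * p' ^ 2 - b' * q' ^ 2 - c' * r' ^ 2 = 1 := by
    rw [← hdet, hc', hp', hq', hb', hr']; ring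
  have hform : ternaryForm a b c p q r x y z
      = ternaryForm a b' c' p' q' r' (x - k * y) (y - m * z) z := by
    unfold ternaryForm
    rw [hc', hp', hq', hb', hr']; ring
  rw [← hheq, ← hgeq] at hm
  rw [← hgeq] at hg hG
  rw [hform]
  generalize x - k * y = x'
  generalize y - m * z = y'
  clear_value r' b' p' q' c'
  by_cases hab : a ≤ b'
  · by_cases hgg : a * b' - r' ^ 2 ≤ a * c' - q' ^ 2
    · exact ⟨_, _, _, (ternaryForm_reduced ha hg hdet' hk hm hab hgg x' y' z).symm⟩
    · have hg' : 0 < a * c' - q' ^ 2 := by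
        have key : (a * b' - r' ^ 2) * (a * c' - q' ^ 2) = a + (a * p' - q' * r') ^ 2 := by
          linear_combination a * hdet'
        exact pos_of_mul_pos_right (by rw [key]; positivity) hg.le
      obtain ⟨u, v, w, h⟩ := ihG _ (by omega) a c' b' p' r' q' ha hg'
        (by linear_combination hdet') x' z y' hA rfl
      exact ⟨u, v, w, by rw [h]; unfold ternaryForm; ring⟩
  · have hb0 : 0 < b' := by
      have : 0 < a * b' := by nlinarith [sq_nonneg r']
      exact pos_of_mul_pos_right this ha.le
    obtain ⟨u, v, w, h⟩ := ihA b'.toNat (by omega) b' a c' q' p' r' hb0 (by linarith)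
      (by linear_combination hdet') y' x' z rfl
    exact ⟨u, v, w, by rw [h]; unfold ternaryForm; ring⟩

theorem exists_prime_two_mul_add_one_eq {n : ℕ} (hn : n % 4 = 1) :
    ∃ p v : ℕ, p.Prime ∧ 2 * p + 1 = (8 * v + 3) * n := by
  obtain ⟨t, rfl⟩ : ∃ t, n = 4 * t + 1 := ⟨n / 4, by omega⟩
  have hcop : Nat.Coprime (6 * t + 1) (4 * (4 * t + 1)) := by
    rw [← Nat.isCoprime_iff_coprime]
    push_cast
    have h4 : IsCoprime (6 * (t : ℤ) + 1) (4 * t + 1) := ⟨-2, 3, by ring⟩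
    have h2 : IsCoprime (6 * (t : ℤ) + 1) 2 := ⟨1, -3 * t, by ring⟩
    have := (h2.mul_right h2).mul_right h4
    norm_num at this
    exact this
  obtain ⟨p, hlt, hp, hmod⟩ := Nat.forall_exists_prime_gt_and_modEq (6 * t + 1)
    (show 4 * (4 * t + 1) ≠ 0 by omega) hcop
  obtain ⟨v, hv⟩ := (Nat.modEq_iff_dvd' hlt.le).1 hmod.symm
  refine ⟨p, v, hp, ?_⟩
  have : p = 4 * (4 * t + 1) * v + (6 * t + 1) := by omega
  rw [this]; ring

theorem exists_dvd_sq_add {n p v : ℕ} (hn : n % 4 = 1) (hp : p.Prime)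
    (h : 2 * p + 1 = (8 * v + 3) * n) :
    ∃ s : ℤ, (2 * p : ℤ) ∣ s ^ 2 + (8 * v + 3) := by
  obtain ⟨t, rfl⟩ : ∃ t, n = 4 * t + 1 := ⟨n / 4, by omega⟩
  have hodd : p % 2 = 1 := by
    have : p = 4 * ((4 * t + 1) * v) + 6 * t + 1 := by linarith
    omega
  have : Fact p.Prime := ⟨hp⟩
  set b := 8 * v + 3 with hb
  have hbo : Odd b := ⟨4 * v + 1, by omega⟩
  have hpo : Odd p := Nat.odd_iff.2 hodd
  have h1 : jacobiSym p b = 1 := by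
    have h2 : jacobiSym (-2 * p) b = 1 := by
      rw [jacobiSym.mod_left' (a₂ := 1), jacobiSym.one_left]
      refine (Int.modEq_iff_dvd.2 ⟨(4 * t + 1 : ℕ), ?_⟩)
      have hz : (2 * p + 1 : ℤ) = b * (4 * t + 1 : ℕ) := by exact_mod_cast h
      linarith
    have h3 : jacobiSym (-2) b = 1 := by
      rw [jacobiSym.at_neg_two hbo, ZMod.χ₈'_nat_eq_if_mod_eight]
      rw [if_neg (by omega), if_pos (by omega)]
    rw [jacobiSym.mul_left, h3, one_mul] at h2
    exact h2
  have h2 : jacobiSym (-b) p = 1 := by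
    rw [jacobiSym.neg _ hpo]
    rcases (by omega : p % 4 = 1 ∨ p % 4 = 3) with h4 | h4
    · rw [ZMod.χ₄_nat_one_mod_four h4, one_mul, ← jacobiSym.quadratic_reciprocity_one_mod_four h4 hbo]
      exact h1
    · rw [ZMod.χ₄_nat_three_mod_four h4,
        jacobiSym.quadratic_reciprocity_three_mod_four (by omega) h4, h1]
      norm_num
  rw [← jacobiSym.legendreSym.to_jacobiSym] at h2
  have h0 : ((-b : ℤ) : ZMod p) ≠ 0 := by
    intro h0
    rw [(legendreSym.eq_zero_iff p _).2 h0] at h2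
    exact zero_ne_one h2
  obtain ⟨s, hs⟩ := (legendreSym.eq_one_iff p h0).1 h2
  obtain ⟨s, rfl⟩ := ZMod.intCast_surjective s
  have hd : ∀ s' : ℤ, (s' : ZMod p) = s → (p : ℤ) ∣ s' ^ 2 + (8 * v + 3) := by
    intro s' hs'
    rw [← ZMod.intCast_zmod_eq_zero_iff_dvd]
    push_cast [hb] at hs ⊢
    rw [hs']
    linear_combination -hs
  have hc : IsCoprime (2 : ℤ) p := by
    have := (Nat.coprime_two_left (n := p)).2 hpo
    exact_mod_cast Nat.isCoprime_iff_coprime.2 this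
  rcases Int.even_or_odd s with he | ho
  · refine ⟨s + p, hc.mul_dvd ?_ (hd _ (by simp))⟩
    have : Odd (s + p) := he.add_odd (by exact_mod_cast hpo)
    have : Even ((s + p) ^ 2 + (8 * v + 3)) := this.pow.add_odd ⟨4 * v + 1, by ring⟩
    exact this.two_dvd
  · refine ⟨s, hc.mul_dvd ?_ (hd _ rfl)⟩
    have : Even (s ^ 2 + (8 * v + 3)) := ho.pow.add_odd ⟨4 * v + 1, by ring⟩
    exact this.two_dvd

/-- Every natural number congruent to one modulo four is a sum of three squares. -/
theorem exists_sq_add_sq_add_sq_of_mod_four_eq_one {n : ℕ} (hn : n % 4 = 1) :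
    ∃ u v w : ℤ, u ^ 2 + v ^ 2 + w ^ 2 = n := by
  obtain ⟨p, v, hp, h⟩ := exists_prime_two_mul_add_one_eq hn
  obtain ⟨s, d, hd⟩ := exists_dvd_sq_add hn hp h
  have hpos : (0 : ℤ) < 2 * p := by have := hp.pos; omega
  have hz : (2 * p + 1 : ℤ) = (8 * v + 3) * n := by exact_mod_cast h
  have hd0 : 0 < d := pos_of_mul_pos_right (by rw [← hd]; positivity) hpos.le
  obtain ⟨x, y, z, hxyz⟩ := exists_sq_add_sq_add_sq_eq_ternaryForm d (2 * p) n 0 1 s hd0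
    (by nlinarith) (by linear_combination -hz - n * hd) 0 0 1
  exact ⟨x, y, z, by rw [hxyz]; unfold ternaryForm; ring⟩

/-- Changing signs and permuting the coordinates of `b` cyclically, one can achieve
`3 (a · b)² ≤ |a|² |b|²`. -/
theorem exists_three_mul_sq_inner_le (a b : Fin 3 → ℤ) :
    ∃ c : Fin 3 → ℤ, ∑ i, c i ^ 2 = ∑ i, b i ^ 2 ∧
      3 * (∑ i, a i * c i) ^ 2 ≤ (∑ i, a i ^ 2) * ∑ i, b i ^ 2 := by
  have sgn : ∀ x y z : ℤ, ∃ c : Fin 3 → ℤ, ∑ i, c i ^ 2 = x ^ 2 + y ^ 2 + z ^ 2 ∧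
      (∑ i, a i * c i) ^ 2 ≤ (a 0 * x) ^ 2 + (a 1 * y) ^ 2 + (a 2 * z) ^ 2 := by
    intro x y z
    by_contra! hc
    have h1 := hc ![x, y, z] (by simp [Fin.sum_univ_three])
    have h2 := hc ![-x, y, z] (by simp [Fin.sum_univ_three])
    have h3 := hc ![x, -y, z] (by simp [Fin.sum_univ_three])
    have h4 := hc ![x, y, -z] (by simp [Fin.sum_univ_three])
    simp [Fin.sum_univ_three] at h1 h2 h3 h4
    linarith
  obtain ⟨c₁, e₁, h₁⟩ := sgn (b 0) (b 1) (b 2)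
  obtain ⟨c₂, e₂, h₂⟩ := sgn (b 1) (b 2) (b 0)
  obtain ⟨c₃, e₃, h₃⟩ := sgn (b 2) (b 0) (b 1)
  by_contra! hc
  have h1 := hc c₁ (by rw [e₁, Fin.sum_univ_three])
  have h2 := hc c₂ (by rw [e₂, Fin.sum_univ_three]; ring)
  have h3 := hc c₃ (by rw [e₃, Fin.sum_univ_three]; ring)
  rw [Fin.sum_univ_three (fun i => a i ^ 2), Fin.sum_univ_three (fun i => b i ^ 2)] at h1 h2 h3
  linarith

theorem abs_inner_le_of_three_mul_sq_le {a c : Fin 3 → ℤ}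
    (h : 3 * (∑ i, a i * c i) ^ 2 ≤ (∑ i, a i ^ 2) * ∑ i, c i ^ 2) :
    |∑ i : Fin 3, ((a i : ℝ) * (c i : ℝ))| ≤
      (1 / Real.sqrt 3) * Real.sqrt (∑ i : Fin 3, (a i : ℝ) ^ 2) *
        Real.sqrt (∑ i : Fin 3, (c i : ℝ) ^ 2) := by
  have h' : 3 * (∑ i, (a i : ℝ) * c i) ^ 2 ≤ (∑ i, (a i : ℝ) ^ 2) * ∑ i, (c i : ℝ) ^ 2 := by
    exact_mod_cast h
  apply abs_le_of_sq_le_sq _ (by positivity)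
  rw [mul_pow, mul_pow, div_pow, Real.sq_sqrt (by positivity), Real.sq_sqrt (by positivity),
    Real.sq_sqrt (by positivity)]
  linarith

/-- **Lemma 1.1.** There is a sequence `(a_k)_{k ≥ 1}` of vectors in `ℤ³` such that
`|a_k|² = 4k+1` and `|a_k · a_{k+1}| ≤ (1/√3)|a_k||a_{k+1}|` for every `k ≥ 1`. -/
theorem statement4 :
    ∃ a : ℕ → Fin 3 → ℤ,
      ∀ k : ℕ, 1 ≤ k →
        ((∑ i : Fin 3, (a k i) ^ 2 = 4 * (k : ℤ) + 1) ∧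
          |∑ i : Fin 3, ((a k i : ℝ) * (a (k + 1) i : ℝ))| ≤
            (1 / Real.sqrt 3) * Real.sqrt (∑ i : Fin 3, (a k i : ℝ) ^ 2) *
              Real.sqrt (∑ i : Fin 3, (a (k + 1) i : ℝ) ^ 2)) := by
  have hrep : ∀ k : ℕ, ∃ b : Fin 3 → ℤ, ∑ i, b i ^ 2 = 4 * (k : ℤ) + 1 := by
    intro k
    obtain ⟨u, v, w, h⟩ :=
      exists_sq_add_sq_add_sq_of_mod_four_eq_one (n := 4 * k + 1) (by omega)
    exact ⟨![u, v, w], by simpa [Fin.sum_univ_three] using h⟩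
  choose b hb using hrep
  choose c hc hle using exists_three_mul_sq_inner_le
  let s : ℕ → Fin 3 → ℤ := fun k => Nat.rec (b 0) (fun k v => c v (b (k + 1))) k
  have hs : ∀ k, s (k + 1) = c (s k) (b (k + 1)) := fun _ => rfl
  have hnorm : ∀ k, ∑ i, s k i ^ 2 = 4 * (k : ℤ) + 1 := by
    intro k
    cases k with
    | zero => exact hb 0
    | succ k => rw [hs, hc, hb]
  refine ⟨s, fun k _ => ⟨hnorm k, abs_inner_le_of_three_mul_sq_le ?_⟩⟩
  rw [hs, hc]
  exact hle _ _
end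

section
/- With f₀ and f as in the context: f is C^∞ on [w₂,∞)×T³, |f(w,y)| ≤ e^{−w^{4/3}} for all (w,y) with w ≥ w₂, and there exists a constant C₁ > 0 depending only on the choice of ζ such that |Δf(w,y)| ≤ C₁·e^{−w^{4/3}} for all (w,y) with w ≥ w₂, where Δ is the Laplacian in all four variables (w,y). -/
open Real MeasureTheory

noncomputable section

/-- `w_k = (27/8)·k^{3/2}`. -/
def wseq (k : ℕ) : ℝ := (27 / 8) * (k : ℝ) ^ ((3 : ℝ) / 2)

/-- The properties of the fixed cutoff function `ζ`: smooth, `ζ = 0` on `(-∞,0]`,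
`ζ = 1` on `[1,∞)`, `0 ≤ ζ ≤ 1`, `ζ' > 0` on `(0,1)`, and `ζ(t) + ζ(1-t) = 1`. -/
def IsCutoff (ζ : ℝ → ℝ) : Prop :=
  ContDiff ℝ (⊤ : ℕ∞) ζ ∧ (∀ t : ℝ, t ≤ 0 → ζ t = 0) ∧ (∀ t : ℝ, 1 ≤ t → ζ t = 1) ∧
    (∀ t : ℝ, ζ t ∈ Set.Icc (0 : ℝ) 1) ∧ (∀ t ∈ Set.Ioo (0 : ℝ) 1, 0 < deriv ζ t) ∧
    (∀ t : ℝ, ζ t + ζ (1 - t) = 1)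

/-- The properties of the fixed sequence `(a_k)` in `ℤ³`:
`|a_k|² = 4k+1` and `|a_k · a_{k+1}| ≤ |a_k||a_{k+1}|/√3` for all `k ≥ 1`. -/
def IsGoodSeq (a : ℕ → Fin 3 → ℤ) : Prop :=
  ∀ k : ℕ, 1 ≤ k →
    ((∑ i : Fin 3, (a k i) ^ 2 = 4 * (k : ℤ) + 1) ∧
      |∑ i : Fin 3, ((a k i : ℝ) * (a (k + 1) i : ℝ))| ≤
        Real.sqrt (∑ i : Fin 3, (a k i : ℝ) ^ 2) *
          Real.sqrt (∑ i : Fin 3, (a (k + 1) i : ℝ) ^ 2) / Real.sqrt 3)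

/-- The function `f₀(w,y) = Σ_{k≥2} ζ((w-w_{k-1})/(w_k-w_{k-1}))·ζ((w_{k+1}-w)/(w_{k+1}-w_k))·cos(a_k·y)`
(a locally finite sum), `2π`-periodic in each coordinate of `y`. -/
def f0 (ζ : ℝ → ℝ) (a : ℕ → Fin 3 → ℤ) (w : ℝ) (y : Fin 3 → ℝ) : ℝ :=
  ∑' k : ℕ, if 2 ≤ k then
      ζ ((w - wseq (k - 1)) / (wseq k - wseq (k - 1))) *
        ζ ((wseq (k + 1) - w) / (wseq (k + 1) - wseq k)) *
        Real.cos (∑ i : Fin 3, (a k i : ℝ) * y i)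
    else 0

/-- `h = (2e)^{-10}`. -/
def hSmall : ℝ := 1 / (2 * Real.exp 1) ^ 10

/-- `Ω = {(w,y) : w ≥ w₂, |f₀(w,y)| < 2h}`, viewed as the (2π-periodic in `y`)
subset of `ℝ × ℝ³` corresponding to a subset of `ℝ × T³`. -/
def OmegaSet (ζ : ℝ → ℝ) (a : ℕ → Fin 3 → ℤ) : Set (ℝ × (Fin 3 → ℝ)) :=
  {p | wseq 2 ≤ p.1 ∧ |f0 ζ a p.1 p.2| < 2 * hSmall}

end

noncomputable section
open Real

/-- The Laplacian in all four variables `(w, y)` of a function on `ℝ × ℝ³`. -/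
def cylLaplacian3 (F : ℝ × (Fin 3 → ℝ) → ℝ) (p : ℝ × (Fin 3 → ℝ)) : ℝ :=
  deriv (deriv (fun t => F (t, p.2))) p.1 +
    ∑ i : Fin 3, deriv (deriv (fun t => F (p.1, Function.update p.2 i t))) (p.2 i)

/-- The function `f(w,y) = f₀(w,y)·e^{-w^{4/3}}`. -/
def fFun (ζ : ℝ → ℝ) (a : ℕ → Fin 3 → ℤ) (w : ℝ) (y : Fin 3 → ℝ) : ℝ :=
  f0 ζ a w y * Real.exp (-(w ^ ((4 : ℝ) / 3)))

lemma sq_rpow_three_halves {x : ℝ} (hx : 0 ≤ x) : x ^ ((3 : ℝ) / 2) = √x ^ 3 := by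
  rw [Real.sqrt_eq_rpow, ← Real.rpow_natCast, ← Real.rpow_mul hx]
  norm_num

lemma wseq_eq_cube (k : ℕ) : wseq k = (3 / 2 * √(k : ℝ)) ^ 3 := by
  rw [wseq, sq_rpow_three_halves k.cast_nonneg]
  ring

lemma wseq_strictMono : StrictMono wseq := by
  intro m n h
  rw [wseq_eq_cube, wseq_eq_cube]
  have : √(m : ℝ) < √(n : ℝ) := Real.sqrt_lt_sqrt m.cast_nonneg (by exact_mod_cast h)
  gcongr

lemma one_le_wseq {k : ℕ} (hk : 1 ≤ k) : 1 ≤ wseq k := by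
  rw [wseq_eq_cube]
  have : 1 ≤ √(k : ℝ) := Real.one_le_sqrt.2 (by exact_mod_cast hk)
  exact one_le_pow₀ (by linarith)

lemma sqrt_le_wseq_succ_sub (k : ℕ) : √((k : ℝ) + 1) ≤ wseq (k + 1) - wseq k := by
  rw [wseq_eq_cube, wseq_eq_cube]
  push_cast
  have hs : √(k : ℝ) ^ 2 = k := Real.sq_sqrt k.cast_nonneg
  have ht : √((k : ℝ) + 1) ^ 2 = k + 1 := Real.sq_sqrt (by positivity)
  have hst : √(k : ℝ) ≤ √((k : ℝ) + 1) := Real.sqrt_le_sqrt (by linarith)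
  have ht1 : 1 ≤ √((k : ℝ) + 1) := Real.one_le_sqrt.2 (by simp)
  have h1 : √((k : ℝ) + 1) ^ 3 = (k + 1) * √((k : ℝ) + 1) := by rw [pow_succ, ht]
  have h2 : √(k : ℝ) ^ 3 = k * √(k : ℝ) := by rw [pow_succ, hs]
  rw [mul_pow, mul_pow, h1, h2]
  nlinarith [mul_le_mul_of_nonneg_left hst (Nat.cast_nonneg (α := ℝ) k)]

lemma exists_wseq_le_lt {w : ℝ} (hw : wseq 2 ≤ w) :
    ∃ k, 2 ≤ k ∧ wseq k ≤ w ∧ w < wseq (k + 1) := by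
  have hunb : ∃ n, w < wseq n := by
    obtain ⟨n, hn⟩ := exists_nat_gt w
    refine ⟨n ^ 2, hn.trans_le ?_⟩
    rw [wseq_eq_cube]
    push_cast
    rw [Real.sqrt_sq n.cast_nonneg]
    rcases n.eq_zero_or_pos with rfl | h
    · simp
    · have : (1 : ℝ) ≤ n := by exact_mod_cast h
      calc (n : ℝ) ≤ 3 / 2 * n := by linarith
        _ ≤ (3 / 2 * n) ^ 3 := le_self_pow₀ (by linarith) (by norm_num)
  classical
  have hlt := Nat.find_spec hunb
  have h2 : 2 < Nat.find hunb := wseq_strictMono.lt_iff_lt.1 (hw.trans_lt hlt)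
  refine ⟨Nat.find hunb - 1, by omega, ?_, ?_⟩
  · exact not_lt.1 (Nat.find_min hunb (by omega))
  · rwa [Nat.sub_add_cancel (by omega)]

/-- The `k`-th cutoff weight in the sum defining `f0`. -/
def cutoffWeight (ζ : ℝ → ℝ) (k : ℕ) (w : ℝ) : ℝ :=
  ζ ((w - wseq (k - 1)) / (wseq k - wseq (k - 1))) *
    ζ ((wseq (k + 1) - w) / (wseq (k + 1) - wseq k))

/-- The phase `a_k · y`. -/
def phase (a : ℕ → Fin 3 → ℤ) (k : ℕ) (y : Fin 3 → ℝ) : ℝ :=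
  ∑ i : Fin 3, (a k i : ℝ) * y i

/-- The weight `e^{-w^{4/3}}`. -/
def decay (w : ℝ) : ℝ := Real.exp (-(w ^ ((4 : ℝ) / 3)))

namespace IsCutoff

variable {ζ : ℝ → ℝ}

lemma contDiff (hζ : IsCutoff ζ) : ContDiff ℝ (⊤ : ℕ∞) ζ := hζ.1

lemma eq_zero (hζ : IsCutoff ζ) {t : ℝ} (ht : t ≤ 0) : ζ t = 0 := hζ.2.1 t ht

lemma eq_one (hζ : IsCutoff ζ) {t : ℝ} (ht : 1 ≤ t) : ζ t = 1 := hζ.2.2.1 t ht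

lemma nonneg (hζ : IsCutoff ζ) (t : ℝ) : 0 ≤ ζ t := (hζ.2.2.2.1 t).1

lemma le_one (hζ : IsCutoff ζ) (t : ℝ) : ζ t ≤ 1 := (hζ.2.2.2.1 t).2

lemma add_one_sub (hζ : IsCutoff ζ) (t : ℝ) : ζ t + ζ (1 - t) = 1 := hζ.2.2.2.2.2 t

lemma contDiff_deriv (hζ : IsCutoff ζ) : ContDiff ℝ (⊤ : ℕ∞) (deriv ζ) :=
  (contDiff_infty_iff_deriv.1 hζ.contDiff).2

lemma hasDerivAt (hζ : IsCutoff ζ) (t : ℝ) : HasDerivAt ζ (deriv ζ t) t :=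
  (hζ.contDiff.differentiable (by simp) t).hasDerivAt

lemma hasDerivAt_deriv (hζ : IsCutoff ζ) (t : ℝ) :
    HasDerivAt (deriv ζ) (deriv (deriv ζ) t) t :=
  (hζ.contDiff_deriv.differentiable (by simp) t).hasDerivAt

lemma deriv_eq_zero (hζ : IsCutoff ζ) {t : ℝ} (ht : t ∉ Set.Icc (0 : ℝ) 1) : deriv ζ t = 0 := by
  rw [Set.mem_Icc, not_and_or, not_le, not_le] at ht
  rcases ht with h | h
  · have : ζ =ᶠ[nhds t] fun _ => 0 := by
      filter_upwards [Iio_mem_nhds h] with s hs using hζ.eq_zero (le_of_lt hs)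
    simp [this.deriv_eq]
  · have : ζ =ᶠ[nhds t] fun _ => 1 := by
      filter_upwards [Ioi_mem_nhds h] with s hs using hζ.eq_one (le_of_lt hs)
    simp [this.deriv_eq]

lemma deriv_deriv_eq_zero (hζ : IsCutoff ζ) {t : ℝ} (ht : t ∉ Set.Icc (0 : ℝ) 1) :
    deriv (deriv ζ) t = 0 := by
  have : deriv ζ =ᶠ[nhds t] fun _ => 0 := by
    filter_upwards [isClosed_Icc.isOpen_compl.mem_nhds ht] with s hs using hζ.deriv_eq_zero hs
  simp [this.deriv_eq]

lemma exists_deriv_bound (hζ : IsCutoff ζ) :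
    ∃ M : ℝ, 0 ≤ M ∧ ∀ t, |deriv ζ t| ≤ M ∧ |deriv (deriv ζ) t| ≤ M := by
  obtain ⟨M₁, h₁⟩ := (isCompact_Icc (a := (0 : ℝ)) (b := 1)).exists_bound_of_continuousOn
    hζ.contDiff_deriv.continuous.continuousOn
  obtain ⟨M₂, h₂⟩ := (isCompact_Icc (a := (0 : ℝ)) (b := 1)).exists_bound_of_continuousOn
    (hζ.contDiff_deriv.continuous_deriv (by simp)).continuousOn
  refine ⟨max 0 (max M₁ M₂), le_max_left _ _, fun t => ?_⟩
  by_cases ht : t ∈ Set.Icc (0 : ℝ) 1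
  · exact ⟨(h₁ t ht).trans (by simp), (h₂ t ht).trans (by simp)⟩
  · simp [hζ.deriv_eq_zero ht, hζ.deriv_deriv_eq_zero ht]

lemma cutoffWeight_nonneg (hζ : IsCutoff ζ) (k : ℕ) (w : ℝ) : 0 ≤ cutoffWeight ζ k w :=
  mul_nonneg (hζ.nonneg _) (hζ.nonneg _)

lemma cutoffWeight_le_one (hζ : IsCutoff ζ) (k : ℕ) (w : ℝ) : cutoffWeight ζ k w ≤ 1 :=
  mul_le_one₀ (hζ.le_one _) (hζ.nonneg _) (hζ.le_one _)

lemma abs_cutoffWeight_le_one (hζ : IsCutoff ζ) (k : ℕ) (w : ℝ) : |cutoffWeight ζ k w| ≤ 1 := by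
  rw [abs_of_nonneg (hζ.cutoffWeight_nonneg k w)]
  exact hζ.cutoffWeight_le_one k w

lemma cutoffWeight_eq_zero_of_le (hζ : IsCutoff ζ) {k : ℕ} {w : ℝ} (h : w ≤ wseq (k - 1)) :
    cutoffWeight ζ k w = 0 := by
  have : wseq (k - 1) ≤ wseq k := wseq_strictMono.monotone (Nat.sub_le k 1)
  rw [cutoffWeight, hζ.eq_zero (div_nonpos_of_nonpos_of_nonneg (by linarith) (by linarith)),
    zero_mul]

lemma cutoffWeight_eq_zero_of_ge (hζ : IsCutoff ζ) {k : ℕ} {w : ℝ} (h : wseq (k + 1) ≤ w) :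
    cutoffWeight ζ k w = 0 := by
  have : wseq k ≤ wseq (k + 1) := wseq_strictMono.monotone (Nat.le_succ k)
  rw [cutoffWeight, hζ.eq_zero (t := (wseq (k + 1) - w) / _)
    (div_nonpos_of_nonpos_of_nonneg (by linarith) (by linarith)), mul_zero]

lemma cutoffWeight_add_succ (hζ : IsCutoff ζ) {k : ℕ} (hk : 1 ≤ k) {w : ℝ}
    (h₁ : wseq k ≤ w) (h₂ : w ≤ wseq (k + 1)) :
    cutoffWeight ζ k w + cutoffWeight ζ (k + 1) w = 1 := by
  have hm : wseq (k - 1) < wseq k := wseq_strictMono (by omega)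
  have h0 : wseq k < wseq (k + 1) := wseq_strictMono (by omega)
  have hp : wseq (k + 1) < wseq (k + 1 + 1) := wseq_strictMono (by omega)
  rw [cutoffWeight, cutoffWeight, Nat.add_sub_cancel,
    hζ.eq_one (t := (w - wseq (k - 1)) / _) ((one_le_div (by linarith)).2 (by linarith)),
    hζ.eq_one (t := (wseq (k + 1 + 1) - w) / _) ((one_le_div (by linarith)).2 (by linarith)),
    one_mul, mul_one, ← hζ.add_one_sub ((w - wseq k) / (wseq (k + 1) - wseq k)), add_comm]
  congr 2
  rw [eq_sub_iff_add_eq, ← add_div, div_eq_one_iff_eq (by linarith)]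
  ring

lemma contDiff_cutoffWeight (hζ : IsCutoff ζ) (k : ℕ) :
    ContDiff ℝ (⊤ : ℕ∞) (cutoffWeight ζ k) := by
  have := hζ.contDiff
  unfold cutoffWeight
  fun_prop

/-- The first two derivatives of a cutoff weight, with bounds. -/
lemma exists_hasDerivAt_cutoffWeight (hζ : IsCutoff ζ) {M : ℝ} (hM₀ : 0 ≤ M)
    (hM : ∀ t, |deriv ζ t| ≤ M ∧ |deriv (deriv ζ) t| ≤ M) {k : ℕ} (hk : 1 ≤ k) :
    ∃ φ' φ'' : ℝ → ℝ, (∀ w, HasDerivAt (cutoffWeight ζ k) (φ' w) w) ∧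
      (∀ w, HasDerivAt φ' (φ'' w) w) ∧
      (∀ w, |φ' w| * √(k : ℝ) ≤ 2 * M) ∧ (∀ w, |φ'' w| ≤ 2 * M + 2 * M ^ 2) := by
  have hk1 : 1 ≤ √(k : ℝ) := Real.one_le_sqrt.2 (by exact_mod_cast hk)
  set d := wseq k - wseq (k - 1)
  set e := wseq (k + 1) - wseq k
  have hdk : √(k : ℝ) ≤ d := by
    have := sqrt_le_wseq_succ_sub (k - 1)
    rwa [Nat.sub_add_cancel hk, Nat.cast_sub hk, Nat.cast_one, sub_add_cancel] at this
  have hek : √(k : ℝ) ≤ e :=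
    (Real.sqrt_le_sqrt (by linarith)).trans (sqrt_le_wseq_succ_sub k)
  have hdpos : 0 < d := by linarith
  have hepos : 0 < e := by linarith
  let p : ℝ → ℝ := fun w => (w - wseq (k - 1)) / d
  let q : ℝ → ℝ := fun w => (wseq (k + 1) - w) / e
  have hp : ∀ w, HasDerivAt p (1 / d) w := fun w =>
    ((hasDerivAt_id w).sub_const _).div_const d
  have hq : ∀ w, HasDerivAt q (-1 / e) w := fun w =>
    ((hasDerivAt_id w).const_sub _).div_const e
  have hζp : ∀ w, HasDerivAt (fun w => ζ (p w)) (deriv ζ (p w) * (1 / d)) w := fun w =>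
    (hζ.hasDerivAt (p w)).comp w (hp w)
  have hζq : ∀ w, HasDerivAt (fun w => ζ (q w)) (deriv ζ (q w) * (-1 / e)) w := fun w =>
    (hζ.hasDerivAt (q w)).comp w (hq w)
  have hζp' : ∀ w, HasDerivAt (fun w => deriv ζ (p w) * (1 / d))
      (deriv (deriv ζ) (p w) * (1 / d) * (1 / d)) w := fun w =>
    ((hζ.hasDerivAt_deriv (p w)).comp w (hp w)).mul_const _
  have hζq' : ∀ w, HasDerivAt (fun w => deriv ζ (q w) * (-1 / e))
      (deriv (deriv ζ) (q w) * (-1 / e) * (-1 / e)) w := fun w =>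
    ((hζ.hasDerivAt_deriv (q w)).comp w (hq w)).mul_const _
  have hdinv : √(k : ℝ) * (1 / d) ≤ 1 := by
    rw [mul_one_div]; exact (div_le_one hdpos).2 hdk
  have heinv : √(k : ℝ) * (1 / e) ≤ 1 := by
    rw [mul_one_div]; exact (div_le_one hepos).2 hek
  have hd1 : 1 / d ≤ 1 := (div_le_one hdpos).2 (by linarith)
  have he1 : 1 / e ≤ 1 := (div_le_one hepos).2 (by linarith)
  have hd0 : 0 ≤ 1 / d := by positivity
  have he0 : 0 ≤ 1 / e := by positivity
  have habs : ∀ t, |ζ t| ≤ 1 := fun t => by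
    rw [abs_of_nonneg (hζ.nonneg t)]; exact hζ.le_one t
  refine ⟨_, _, fun w => (hζp w).mul (hζq w),
    fun w => ((hζp' w).mul (hζq w)).add ((hζp w).mul (hζq' w)), fun w => ?_, fun w => ?_⟩
  · calc _ ≤ (M * (1 / d) * 1 + 1 * (M * (1 / e))) * √(k : ℝ) := by
          gcongr
          refine (abs_add_le _ _).trans ?_
          simp only [abs_mul, abs_of_nonneg hd0, neg_div, abs_neg, abs_of_nonneg he0]
          gcongr
          exacts [(hM _).1, habs _, habs _, (hM _).1]
      _ = M * (√(k : ℝ) * (1 / d)) + M * (√(k : ℝ) * (1 / e)) := by ring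
      _ ≤ M * 1 + M * 1 := by gcongr
      _ = 2 * M := by ring
  · calc _ ≤ (M * 1 * 1 * 1 + M * 1 * (M * 1)) + (M * 1 * (M * 1) + 1 * (M * 1 * 1)) := by
          refine (abs_add_le _ _).trans (add_le_add ((abs_add_le _ _).trans ?_)
            ((abs_add_le _ _).trans ?_)) <;>
          · simp only [abs_mul, abs_of_nonneg hd0, neg_div, abs_neg, abs_of_nonneg he0]
            gcongr
            all_goals first | exact (hM _).1 | exact (hM _).2 | exact habs _
      _ = 2 * M + 2 * M ^ 2 := by ring

end IsCutoff

lemma f0_eq_sum {ζ : ℝ → ℝ} (hζ : IsCutoff ζ) (a : ℕ → Fin 3 → ℤ) {k : ℕ} {w : ℝ}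
    (h₁ : wseq (k - 1) ≤ w) (h₂ : w ≤ wseq (k + 1)) (y : Fin 3 → ℝ) :
    f0 ζ a w y = ∑ j ∈ (Finset.Icc (k - 1) (k + 1)).filter (2 ≤ ·),
      cutoffWeight ζ j w * Real.cos (phase a j y) := by
  rw [Finset.sum_filter]
  refine tsum_eq_sum fun j hj => ?_
  rw [← cutoffWeight, ← phase]
  rw [Finset.mem_Icc, not_and_or, not_le, not_le] at hj
  have : cutoffWeight ζ j w = 0 := by
    rcases hj with hj | hj
    · exact hζ.cutoffWeight_eq_zero_of_ge ((wseq_strictMono.monotone (by omega)).trans h₁)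
    · exact hζ.cutoffWeight_eq_zero_of_le (h₂.trans (wseq_strictMono.monotone (by omega)))
  simp [this]

lemma abs_f0_le_one {ζ : ℝ → ℝ} (hζ : IsCutoff ζ) (a : ℕ → Fin 3 → ℤ) {w : ℝ}
    (hw : wseq 2 ≤ w) (y : Fin 3 → ℝ) : |f0 ζ a w y| ≤ 1 := by
  obtain ⟨k, hk, h₁, h₂⟩ := exists_wseq_le_lt hw
  rw [f0_eq_sum hζ a ((wseq_strictMono.monotone (by omega)).trans h₁) h₂.le]
  calc _ ≤ ∑ j ∈ (Finset.Icc (k - 1) (k + 1)).filter (2 ≤ ·), cutoffWeight ζ j w := by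
        refine (Finset.abs_sum_le_sum_abs _ _).trans (Finset.sum_le_sum fun j _ => ?_)
        rw [abs_mul, abs_of_nonneg (hζ.cutoffWeight_nonneg j w)]
        exact mul_le_of_le_one_right (hζ.cutoffWeight_nonneg j w) (Real.abs_cos_le_one _)
    _ ≤ ∑ j ∈ Finset.Icc (k - 1) (k + 1), cutoffWeight ζ j w :=
        Finset.sum_le_sum_of_subset_of_nonneg (Finset.filter_subset _ _)
          fun j _ _ => hζ.cutoffWeight_nonneg j w
    _ = cutoffWeight ζ k w + cutoffWeight ζ (k + 1) w := by
        obtain ⟨m, rfl⟩ : ∃ m, k = m + 1 := ⟨k - 1, by omega⟩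
        rw [Nat.add_sub_cancel, Finset.sum_Icc_succ_top (by omega),
          Finset.sum_Icc_succ_top (by omega), Finset.Icc_self, Finset.sum_singleton,
          hζ.cutoffWeight_eq_zero_of_ge h₁, zero_add]
    _ = 1 := hζ.cutoffWeight_add_succ (by omega) h₁ h₂.le

lemma hasDerivAt_decay {w : ℝ} (hw : 0 < w) :
    HasDerivAt decay (-(4 / 3 * w ^ ((1 : ℝ) / 3)) * decay w) w := by
  refine HasDerivAt.congr_deriv (f := decay)
    ((Real.hasDerivAt_rpow_const (p := (4 : ℝ) / 3) (Or.inl hw.ne')).neg).exp ?_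
  simp only [decay, Pi.neg_apply]
  rw [show (4 : ℝ) / 3 - 1 = 1 / 3 by norm_num]
  ring

lemma contDiffAt_decay {w : ℝ} (hw : 0 < w) : ContDiffAt ℝ (⊤ : ℕ∞) decay w :=
  ((Real.contDiffAt_rpow_const_of_ne hw.ne').neg).exp

lemma hasDerivAt_rpow_third {w : ℝ} (hw : 0 < w) :
    HasDerivAt (fun w : ℝ => -(4 / 3 * w ^ ((1 : ℝ) / 3)))
      (-(4 / 9 * w ^ (-(2 : ℝ) / 3))) w := by
  refine ((Real.hasDerivAt_rpow_const (p := (1 : ℝ) / 3) (Or.inl hw.ne')).const_mul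
    (4 / 3)).neg.congr_deriv ?_
  rw [show (1 : ℝ) / 3 - 1 = -2 / 3 by norm_num]
  ring

lemma deriv_deriv_eq_of_hasDerivAt {g g' : ℝ → ℝ} {x g'' : ℝ}
    (h₁ : ∀ᶠ t in nhds x, HasDerivAt g (g' t) t) (h₂ : HasDerivAt g' g'' x) :
    deriv (deriv g) x = g'' := by
  have : deriv g =ᶠ[nhds x] g' := h₁.mono fun t ht => ht.deriv
  rw [this.deriv_eq, h₂.deriv]

lemma hasDerivAt_phase_update (a : ℕ → Fin 3 → ℤ) (k : ℕ) (y : Fin 3 → ℝ) (i : Fin 3) (t : ℝ) :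
    HasDerivAt (fun t => phase a k (Function.update y i t)) (a k i) t := by
  have h : HasDerivAt (fun t => phase a k (Function.update y i t))
      (∑ l, (a k l : ℝ) * (Pi.single i (1 : ℝ) : Fin 3 → ℝ) l) t :=
    HasDerivAt.fun_sum fun l _ => (hasDerivAt_pi.1 (hasDerivAt_update y i t) l).const_mul _
  simpa [Pi.single_apply] using h

/-- With `r = w^{1/3}`, the comparison of `(16/9) r²` with the frequency `4k+1`, and the bound
of `r` by a multiple of `√k`, for `w` near `wseq k`. -/
lemma rpow_third_bounds {k : ℕ} (hk : 2 ≤ k) {w : ℝ} (h₁ : wseq (k - 1) ≤ w)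
    (h₂ : w ≤ wseq (k + 2)) :
    w ^ ((1 : ℝ) / 3) ≤ 3 * √(k : ℝ) ∧
      |16 / 9 * (w ^ ((1 : ℝ) / 3)) ^ 2 - (4 * k + 1)| ≤ 8 := by
  have hk2 : (2 : ℝ) ≤ k := by exact_mod_cast hk
  have hw1 : 1 ≤ w := (one_le_wseq (by omega)).trans h₁
  set r := w ^ ((1 : ℝ) / 3) with hr
  have hr0 : 0 ≤ r := by positivity
  have hr3 : r ^ 3 = w := by
    rw [hr, ← Real.rpow_natCast, ← Real.rpow_mul (by linarith)]; norm_num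
  rw [← hr3, wseq_eq_cube, Nat.cast_sub (by omega)] at h₁
  rw [← hr3, wseq_eq_cube] at h₂
  push_cast at h₁ h₂
  have hlo := le_of_pow_le_pow_left₀ (by norm_num) hr0 h₁
  have hhi := le_of_pow_le_pow_left₀ (by norm_num) (by positivity) h₂
  have hlo2 := pow_le_pow_left₀ (by positivity) hlo 2
  have hhi2 := pow_le_pow_left₀ hr0 hhi 2
  rw [mul_pow, Real.sq_sqrt (by linarith)] at hlo2
  rw [mul_pow, Real.sq_sqrt (by linarith)] at hhi2
  refine ⟨le_of_sq_le_sq ?_ (by positivity), ?_⟩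
  · rw [mul_pow, Real.sq_sqrt (by linarith)]
    linarith
  · rw [abs_le]
    constructor <;> linarith

/-- The second derivative of `cutoffWeight ζ k * decay` differs from `4k+1` times the function by
at most a multiple of `decay` near `wseq k`. -/
lemma mode_deriv_bounds {ζ : ℝ → ℝ} (hζ : IsCutoff ζ) {M : ℝ} (hM₀ : 0 ≤ M)
    (hM : ∀ t, |deriv ζ t| ≤ M ∧ |deriv (deriv ζ) t| ≤ M) {k : ℕ} (hk : 2 ≤ k) :
    ∃ g' g'' : ℝ → ℝ,
      (∀ w, 0 < w → HasDerivAt (fun w => cutoffWeight ζ k w * decay w) (g' w) w) ∧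
      (∀ w, 0 < w → HasDerivAt g' (g'' w) w) ∧
      ∀ w, wseq (k - 1) ≤ w → w ≤ wseq (k + 2) →
        |g'' w - (4 * k + 1) * (cutoffWeight ζ k w * decay w)| ≤
          (18 * M + 2 * M ^ 2 + 9) * decay w := by
  obtain ⟨φ', φ'', h', h'', hb', hb''⟩ :=
    hζ.exists_hasDerivAt_cutoffWeight hM₀ hM (show 1 ≤ k by omega)
  refine ⟨_, _, fun w hw => (h' w).mul (hasDerivAt_decay hw),
    fun w hw => ((h'' w).mul (hasDerivAt_decay hw)).add
      ((h' w).mul ((hasDerivAt_rpow_third hw).mul (hasDerivAt_decay hw))), fun w h₁ h₂ => ?_⟩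
  obtain ⟨hr, hfreq⟩ := rpow_third_bounds hk h₁ h₂
  have hw1 : 1 ≤ w := (one_le_wseq (by omega)).trans h₁
  have hs : |w ^ (-(2 : ℝ) / 3)| ≤ 1 := by
    rw [abs_of_nonneg (by positivity)]
    exact Real.rpow_le_one_of_one_le_of_nonpos hw1 (by norm_num)
  have hr0 : 0 ≤ w ^ ((1 : ℝ) / 3) := by positivity
  have hE : 0 < decay w := Real.exp_pos _
  have hφ := hζ.abs_cutoffWeight_le_one k w
  have hb1 := hb' w
  have hb2 := hb'' w
  generalize w ^ ((1 : ℝ) / 3) = r at *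
  generalize w ^ (-(2 : ℝ) / 3) = s at *
  generalize cutoffWeight ζ k w = φ at *
  generalize decay w = E at *
  generalize φ' w = x at *
  generalize φ'' w = z at *
  have hxr : |x| * r ≤ 6 * M := by
    calc |x| * r ≤ |x| * (3 * √(k : ℝ)) := by gcongr
      _ ≤ 6 * M := by linarith
  have hfactor : ∀ D : ℝ, |D| ≤ 18 * M + 2 * M ^ 2 + 9 →
      |D * E| ≤ (18 * M + 2 * M ^ 2 + 9) * E := fun D hD => by
    rw [abs_mul, abs_of_pos hE]; gcongr
  convert hfactor (z - 8 / 3 * (x * r) + φ * (16 / 9 * r ^ 2 - (4 * k + 1)) - 4 / 9 * (φ * s)) ?_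
    using 2
  · ring
  · calc _ ≤ |z| + 8 / 3 * (|x| * r) + |φ| * |16 / 9 * r ^ 2 - (4 * k + 1)|
          + 4 / 9 * (|φ| * |s|) := by
          refine (abs_sub _ _).trans (add_le_add ((abs_add_le _ _).trans
            (add_le_add ((abs_sub _ _).trans (add_le_add le_rfl ?_)) ?_)) ?_)
          · rw [abs_mul, abs_mul, abs_of_nonneg hr0, abs_of_pos (by norm_num : (0 : ℝ) < 8 / 3)]
          · rw [abs_mul]
          · rw [abs_mul, abs_mul, abs_of_pos (by norm_num : (0 : ℝ) < 4 / 9)]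
      _ ≤ (2 * M + 2 * M ^ 2) + 8 / 3 * (6 * M) + 1 * 8 + 4 / 9 * (1 * 1) := by gcongr
      _ ≤ _ := by linarith

lemma fFun_eq_sum {ζ : ℝ → ℝ} (hζ : IsCutoff ζ) (a : ℕ → Fin 3 → ℤ) {k : ℕ} {w : ℝ}
    (h₁ : wseq (k - 1) ≤ w) (h₂ : w ≤ wseq (k + 1)) (y : Fin 3 → ℝ) :
    fFun ζ a w y = ∑ j ∈ (Finset.Icc (k - 1) (k + 1)).filter (2 ≤ ·),
      cutoffWeight ζ j w * decay w * Real.cos (phase a j y) := by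
  rw [fFun, f0_eq_sum hζ a h₁ h₂, ← decay, Finset.sum_mul]
  exact Finset.sum_congr rfl fun j _ => by ring

lemma contDiffAt_fFun {ζ : ℝ → ℝ} (hζ : IsCutoff ζ) (a : ℕ → Fin 3 → ℤ)
    {p : ℝ × (Fin 3 → ℝ)} (hp : wseq 2 ≤ p.1) :
    ContDiffAt ℝ (⊤ : ℕ∞) (fun p : ℝ × (Fin 3 → ℝ) => fFun ζ a p.1 p.2) p := by
  obtain ⟨k, hk, h₁, h₂⟩ := exists_wseq_le_lt hp
  have hlt : wseq (k - 1) < p.1 := (wseq_strictMono (by omega)).trans_le h₁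
  have hpos : 0 < p.1 := by linarith [one_le_wseq (show 1 ≤ 2 by norm_num)]
  have hev : (fun p : ℝ × (Fin 3 → ℝ) => fFun ζ a p.1 p.2) =ᶠ[nhds p] fun p =>
      ∑ j ∈ (Finset.Icc (k - 1) (k + 1)).filter (2 ≤ ·),
        cutoffWeight ζ j p.1 * decay p.1 * Real.cos (phase a j p.2) := by
    filter_upwards [continuous_fst.continuousAt.preimage_mem_nhds (Ioo_mem_nhds hlt h₂)]
      with q hq using fFun_eq_sum hζ a hq.1.le hq.2.le q.2
  refine ContDiffAt.congr_of_eventuallyEq (ContDiffAt.sum fun j _ => ?_) hev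
  refine ((((hζ.contDiff_cutoffWeight j).comp contDiff_fst).contDiffAt).mul
    ((contDiffAt_decay hpos).comp p contDiffAt_fst)).mul ?_
  unfold phase
  fun_prop

lemma cylLaplacian3_fFun_eq {ζ : ℝ → ℝ} (hζ : IsCutoff ζ) (a : ℕ → Fin 3 → ℤ) {k : ℕ}
    (hk : 2 ≤ k) {w : ℝ} (h₁ : wseq (k - 1) < w) (h₂ : w < wseq (k + 1)) (y : Fin 3 → ℝ)
    {g' g'' : ℕ → ℝ → ℝ}
    (hg' : ∀ j, 2 ≤ j → ∀ w, 0 < w →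
      HasDerivAt (fun w => cutoffWeight ζ j w * decay w) (g' j w) w)
    (hg'' : ∀ j, 2 ≤ j → ∀ w, 0 < w → HasDerivAt (g' j) (g'' j w) w) :
    cylLaplacian3 (fun p => fFun ζ a p.1 p.2) (w, y) =
      ∑ j ∈ (Finset.Icc (k - 1) (k + 1)).filter (2 ≤ ·),
        (g'' j w - (∑ i, (a j i : ℝ) ^ 2) * (cutoffWeight ζ j w * decay w)) *
          Real.cos (phase a j y) := by
  have hpos : 0 < w := by linarith [one_le_wseq (show 1 ≤ k - 1 by omega)]
  have hw : deriv (deriv fun t => fFun ζ a t y) w =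
      ∑ j ∈ (Finset.Icc (k - 1) (k + 1)).filter (2 ≤ ·), g'' j w * Real.cos (phase a j y) := by
    have hev : (fun t => fFun ζ a t y) =ᶠ[nhds w] fun t =>
        ∑ j ∈ (Finset.Icc (k - 1) (k + 1)).filter (2 ≤ ·),
          cutoffWeight ζ j t * decay t * Real.cos (phase a j y) := by
      filter_upwards [Ioo_mem_nhds h₁ h₂] with t ht using fFun_eq_sum hζ a ht.1.le ht.2.le y
    rw [hev.deriv.deriv_eq]
    refine deriv_deriv_eq_of_hasDerivAt
      (g' := fun t => ∑ j ∈ (Finset.Icc (k - 1) (k + 1)).filter (2 ≤ ·),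
        g' j t * Real.cos (phase a j y)) ?_ ?_
    · filter_upwards [Ioi_mem_nhds hpos] with t ht
      exact HasDerivAt.fun_sum fun j hj =>
        (hg' j (Finset.mem_filter.1 hj).2 t ht).mul_const _
    · exact HasDerivAt.fun_sum fun j hj =>
        (hg'' j (Finset.mem_filter.1 hj).2 w hpos).mul_const _
  have hy : ∀ i, deriv (deriv fun t => fFun ζ a w (Function.update y i t)) (y i) =
      ∑ j ∈ (Finset.Icc (k - 1) (k + 1)).filter (2 ≤ ·),
        cutoffWeight ζ j w * decay w * (-(Real.cos (phase a j y) * a j i) * (a j i : ℝ)) := by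
    intro i
    simp only [fFun_eq_sum hζ a h₁.le h₂.le]
    refine deriv_deriv_eq_of_hasDerivAt (Filter.Eventually.of_forall fun t =>
      HasDerivAt.fun_sum fun j _ =>
        ((hasDerivAt_phase_update a j y i t).cos.const_mul _)) ?_
    refine HasDerivAt.fun_sum fun j _ => HasDerivAt.const_mul _ ?_
    refine (((hasDerivAt_phase_update a j y i (y i)).sin.neg).mul_const (a j i : ℝ)).congr_deriv ?_
    rw [Function.update_eq_self]
  simp only [cylLaplacian3, hw, hy]
  rw [Finset.sum_comm, ← Finset.sum_add_distrib]
  refine Finset.sum_congr rfl fun j _ => ?_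
  rw [← Finset.mul_sum, sub_mul, sub_eq_add_neg, Finset.sum_mul, Finset.sum_mul,
    ← Finset.sum_neg_distrib, Finset.mul_sum]
  congr 1
  exact Finset.sum_congr rfl fun i _ => by ring

/-- **Lemma 1.3.** `f ∈ C^∞([w₂,∞)×T³)`, `|f(w,y)| ≤ e^{-w^{4/3}}` for `w ≥ w₂`, and
there is a constant `C₁ > 0` depending only on `ζ` with `|Δf(w,y)| ≤ C₁·e^{-w^{4/3}}`
for `w ≥ w₂`, where `Δ` is the Laplacian in all four variables. -/
theorem statement6 (ζ : ℝ → ℝ) (hζ : IsCutoff ζ) :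
    ∃ C₁ : ℝ, 0 < C₁ ∧
      ∀ a : ℕ → Fin 3 → ℤ, IsGoodSeq a →
        (ContDiffOn ℝ (⊤ : ℕ∞) (fun p : ℝ × (Fin 3 → ℝ) => fFun ζ a p.1 p.2)
            {p : ℝ × (Fin 3 → ℝ) | wseq 2 ≤ p.1}) ∧
        (∀ (w : ℝ) (y : Fin 3 → ℝ), wseq 2 ≤ w →
          |fFun ζ a w y| ≤ Real.exp (-(w ^ ((4 : ℝ) / 3)))) ∧
        (∀ (w : ℝ) (y : Fin 3 → ℝ), wseq 2 ≤ w →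
          |cylLaplacian3 (fun p => fFun ζ a p.1 p.2) (w, y)| ≤
            C₁ * Real.exp (-(w ^ ((4 : ℝ) / 3)))) := by
  obtain ⟨M, hM₀, hM⟩ := hζ.exists_deriv_bound
  refine ⟨3 * (18 * M + 2 * M ^ 2 + 9), by positivity, fun a ha =>
    ⟨fun p hp => (contDiffAt_fFun hζ a hp).contDiffWithinAt, fun w y hw => ?_,
      fun w y hw => ?_⟩⟩
  · rw [fFun, abs_mul, abs_of_pos (Real.exp_pos _)]
    exact mul_le_of_le_one_left (Real.exp_pos _).le (abs_f0_le_one hζ a hw y)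
  · obtain ⟨k, hk, h₁, h₂⟩ := exists_wseq_le_lt hw
    choose! g' g'' hg' hg'' hb using fun j (hj : 2 ≤ j) => mode_deriv_bounds hζ hM₀ hM hj
    have hE : 0 < decay w := Real.exp_pos _
    rw [cylLaplacian3_fFun_eq hζ a hk ((wseq_strictMono (by omega)).trans_le h₁) h₂ y hg' hg'',
      ← decay]
    calc _ ≤ ∑ j ∈ (Finset.Icc (k - 1) (k + 1)).filter (2 ≤ ·),
          (18 * M + 2 * M ^ 2 + 9) * decay w := by
          refine (Finset.abs_sum_le_sum_abs _ _).trans (Finset.sum_le_sum fun j hj => ?_)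
          rw [Finset.mem_filter, Finset.mem_Icc] at hj
          have hfreq : ∑ i, (a j i : ℝ) ^ 2 = 4 * j + 1 := by
            exact_mod_cast (ha j (by omega)).1
          rw [abs_mul, hfreq]
          exact (mul_le_of_le_one_right (abs_nonneg _) (Real.abs_cos_le_one _)).trans
            (hb j hj.2 w ((wseq_strictMono.monotone (by omega)).trans h₁)
              (h₂.le.trans (wseq_strictMono.monotone (by omega))))
      _ ≤ ∑ j ∈ Finset.Icc (k - 1) (k + 1), (18 * M + 2 * M ^ 2 + 9) * decay w :=
          Finset.sum_le_sum_of_subset_of_nonneg (Finset.filter_subset _ _)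
            fun j _ _ => by positivity
      _ = 3 * (18 * M + 2 * M ^ 2 + 9) * decay w := by
          rw [Finset.sum_const, Nat.card_Icc, show k + 1 + 1 - (k - 1) = 3 by omega, nsmul_eq_mul]
          push_cast
          ring

end
end
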